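/- Suppose α = {α_t : t ≥ 0} is an E₀-semigroup on a factorial non-commutative probability space (M,φ) with φ faithful, M acting standardly on L²(M,φ). Then: (1) the equation α′_t(x′) = j(α_t(j(x′))) for x′ ∈ M′ defines an E₀-semigroup {α′_t : t ≥ 0} on (M′, φ′), where φ′ is the vector state of 1̂_M on M′; (2) if each α_t is equi-modular and extendable, then there exists a unique E₀-semigroup {α⁽²⁾_t : t ≥ 0} on (B(L²(M,φ)), vector state of 1̂_M) such that α⁽²⁾_t(x x′) = α_t(x) α′_t(x′) for all x ∈ M, x′ ∈ M′, t ≥ 0. -/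

import Mathlib

set_option synthInstance.maxHeartbeats 400000
set_option maxHeartbeats 1000000

open scoped InnerProductSpace ComplexConjugate

noncomputable section

namespace Paper

variable {H : Type} [NormedAddCommGroup H] [InnerProductSpace ℂ H] [CompleteSpace H]
variable {H' : Type} [NormedAddCommGroup H'] [InnerProductSpace ℂ H'] [CompleteSpace H']

/-- An operator is a (self-adjoint, idempotent) orthogonal projection. -/
def IsProjection (p : H →L[ℂ] H) : Prop := IsSelfAdjoint p ∧ p * p = p

/-- The vector state determined by a vector `Ω`. -/
def vecState (Ω : H) (x : H →L[ℂ] H) : ℂ := ⟪x Ω, Ω⟫_ℂ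

/-- A normal state on a von Neumann algebra, described via its canonical form as a
countable convex combination of vector states. -/
def IsNormalState (M : Set (H →L[ℂ] H)) (φ : (H →L[ℂ] H) → ℂ) : Prop :=
  ∃ ξ : ℕ → H, (Summable fun n => ‖ξ n‖ ^ 2) ∧ (∑' n, ‖ξ n‖ ^ 2) = 1 ∧
    ∀ x ∈ M, φ x = ∑' n, ⟪x (ξ n), ξ n⟫_ℂ

/-- Normality (complete additivity) of a map between operator algebras: it is `σ`-weakly
continuous, equivalently it preserves sums of orthogonal families of projections lying in the
given domain `S`. -/
def IsNormalMapOn (S : Set (H →L[ℂ] H)) (Θ : (H →L[ℂ] H) → (H' →L[ℂ] H')) : Prop :=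
  ∀ {ι : Type} (p : ι → (H →L[ℂ] H)) (q : H →L[ℂ] H),
    (∀ i, p i ∈ S) → q ∈ S →
    (∀ i, IsProjection (p i)) → (∀ i k, i ≠ k → p i * p k = 0) →
    (∀ ξ : H, HasSum (fun i => p i ξ) (q ξ)) →
    ∀ ξ : H', HasSum (fun i => Θ (p i) ξ) (Θ q ξ)

/-- `Θ` is a `*`-homomorphism on the subset `S` (typically a von Neumann algebra). -/
structure IsStarHomOn (S : Set (H →L[ℂ] H)) (Θ : (H →L[ℂ] H) → (H' →L[ℂ] H')) : Prop where
  map_add : ∀ x ∈ S, ∀ y ∈ S, Θ (x + y) = Θ x + Θ y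
  map_smul : ∀ (c : ℂ), ∀ x ∈ S, Θ (c • x) = c • Θ x
  map_mul : ∀ x ∈ S, ∀ y ∈ S, Θ (x * y) = Θ x * Θ y
  map_star : ∀ x ∈ S, Θ (star x) = star (Θ x)

/-- The (self-adjoint part of the) center of `S` is trivial. -/
def IsFactorSet (S : Set (H →L[ℂ] H)) : Prop :=
  ∀ x ∈ S, (∀ y ∈ S, x * y = y * x) → ∃ c : ℂ, x = c • (1 : H →L[ℂ] H)

/-- A type `I` factor: a factor possessing a minimal projection. -/
def IsTypeIFactorSet (S : Set (H →L[ℂ] H)) : Prop :=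
  IsFactorSet S ∧ ∃ p ∈ S, p ≠ 0 ∧ IsProjection p ∧
    ∀ q ∈ S, IsProjection q → q * p = q → q = 0 ∨ q = p

/-- `z` is the central support of the normal state `φ` of the von Neumann algebra `S`, i.e. the
smallest central projection of full measure. -/
structure IsCentralSupport (S : Set (H →L[ℂ] H)) (φ : (H →L[ℂ] H) → ℂ) (z : H →L[ℂ] H) :
    Prop where
  mem : z ∈ S
  proj : IsProjection z
  central : ∀ y ∈ S, z * y = y * z
  full : φ z = 1
  min : ∀ w ∈ S, IsProjection w → (∀ y ∈ S, w * y = y * w) → φ w = 1 → z * w = z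

/-- The von Neumann algebra generated by a (self-adjoint) set of operators. -/
def vN (S : Set (H →L[ℂ] H)) : Set (H →L[ℂ] H) := Set.centralizer (Set.centralizer S)

/-- Standard form data for a von Neumann algebra `M` with cyclic separating unit vector `Ω`:
`J` is the modular conjugation (an antiunitary involution fixing `Ω`, conjugating `M` onto its
commutant, and positive on the cone `{x j(x) Ω}`), and `j = J (·) J`. -/
structure StandardForm (M : VonNeumannAlgebra H) (Ω : H) (J : H → H)
    (j : (H →L[ℂ] H) → (H →L[ℂ] H)) : Prop where
  unit : ‖Ω‖ = 1
  cyclic : Dense {ξ : H | ∃ x ∈ M, x Ω = ξ}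
  separating : ∀ x ∈ M, x Ω = 0 → x = 0
  Jadd : ∀ ξ η : H, J (ξ + η) = J ξ + J η
  Jsmul : ∀ (c : ℂ) (ξ : H), J (c • ξ) = (starRingEnd ℂ) c • J ξ
  Jinvol : ∀ ξ : H, J (J ξ) = ξ
  Jinner : ∀ ξ η : H, ⟪J ξ, J η⟫_ℂ = ⟪η, ξ⟫_ℂ
  JΩ : J Ω = Ω
  jdef : ∀ (x : H →L[ℂ] H) (ξ : H), j x ξ = J (x (J ξ))
  jmapsTo : ∀ x ∈ M, j x ∈ Set.centralizer (M : Set (H →L[ℂ] H))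
  jsurj : ∀ y ∈ Set.centralizer (M : Set (H →L[ℂ] H)), ∃ x ∈ M, j x = y
  pos : ∀ x ∈ M, 0 ≤ (⟪(x * j x) Ω, Ω⟫_ℂ).re ∧ (⟪(x * j x) Ω, Ω⟫_ℂ).im = 0

/-- A unital `*`-endomorphism of `M` preserving the (faithful, normal) vector state of `Ω`. -/
structure StateEndo (M : VonNeumannAlgebra H) (Ω : H)
    (θ : (H →L[ℂ] H) → (H →L[ℂ] H)) : Prop where
  mapsTo : Set.MapsTo θ (M : Set (H →L[ℂ] H)) (M : Set (H →L[ℂ] H))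
  unital : θ 1 = 1
  hom : IsStarHomOn (M : Set (H →L[ℂ] H)) θ
  state : ∀ x ∈ M, ⟪θ x Ω, Ω⟫_ℂ = ⟪x Ω, Ω⟫_ℂ

/-- `u` is the isometry of the GNS space implementing `θ`:  `u x Ω = θ(x) Ω`. -/
def Implements (M : VonNeumannAlgebra H) (Ω : H) (θ : (H →L[ℂ] H) → (H →L[ℂ] H))
    (u : H →L[ℂ] H) : Prop :=
  (∀ ξ : H, ‖u ξ‖ = ‖ξ‖) ∧ ∀ x ∈ M, u (x Ω) = θ x Ω

/-- `u` commutes with the modular conjugation `J`. -/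
def CommutesWithJ (J : H → H) (u : H →L[ℂ] H) : Prop := ∀ ξ : H, u (J ξ) = J (u ξ)

/-- `θ` is equi-modular: its implementing isometry commutes with `J`. -/
def EquiModular (M : VonNeumannAlgebra H) (Ω : H) (J : H → H)
    (θ : (H →L[ℂ] H) → (H →L[ℂ] H)) : Prop :=
  ∃ u : H →L[ℂ] H, Implements M Ω θ u ∧ CommutesWithJ J u

/-- `Θ = θ⁽²⁾` is a unital normal `*`-endomorphism of `B(L²(M,φ))` extending `θ` and
`j ∘ θ ∘ j`. -/
structure IsExtension (M : VonNeumannAlgebra H) (j : (H →L[ℂ] H) → (H →L[ℂ] H))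
    (θ : (H →L[ℂ] H) → (H →L[ℂ] H)) (Θ : (H →L[ℂ] H) → (H →L[ℂ] H)) : Prop where
  hom : IsStarHomOn (Set.univ : Set (H →L[ℂ] H)) Θ
  unital : Θ 1 = 1
  normal : IsNormalMapOn (Set.univ : Set (H →L[ℂ] H)) Θ
  onM : ∀ x ∈ M, Θ x = θ x
  onComm : ∀ x ∈ M, Θ (j x) = j (θ x)

/-- `θ` is extendable. -/
def Extendable (M : VonNeumannAlgebra H) (j : (H →L[ℂ] H) → (H →L[ℂ] H))
    (θ : (H →L[ℂ] H) → (H →L[ℂ] H)) : Prop :=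
  ∃ Θ : (H →L[ℂ] H) → (H →L[ℂ] H), IsExtension M j θ Θ

/-- An `E₀`-semigroup on the von Neumann probability space `(M, ⟨·Ω,Ω⟩)`. -/
structure IsE0Semigroup (M : VonNeumannAlgebra H) (Ω : H)
    (α : ℝ → (H →L[ℂ] H) → (H →L[ℂ] H)) : Prop where
  endo : ∀ t : ℝ, 0 ≤ t → StateEndo M Ω (α t)
  id0 : ∀ x ∈ M, α 0 x = x
  semigroup : ∀ s t : ℝ, 0 ≤ s → 0 ≤ t → ∀ x ∈ M, α s (α t x) = α (s + t) x
  weakCont : ∀ x ∈ M, ∀ ξ η : H, ContinuousOn (fun t : ℝ => ⟪α t x ξ, η⟫_ℂ) (Set.Ici 0)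

/-- An `E₀`-semigroup on the von Neumann probability space `(S, ⟨·Ω,Ω⟩)`, where `S` is the
underlying set of a von Neumann algebra acting on `H`. -/
structure IsE0SemigroupSet (S : Set (H →L[ℂ] H)) (Ω : H)
    (α : ℝ → (H →L[ℂ] H) → (H →L[ℂ] H)) : Prop where
  mapsTo : ∀ t : ℝ, 0 ≤ t → Set.MapsTo (α t) S S
  unital : ∀ t : ℝ, 0 ≤ t → α t 1 = 1
  hom : ∀ t : ℝ, 0 ≤ t → IsStarHomOn S (α t)
  normal : ∀ t : ℝ, 0 ≤ t → IsNormalMapOn S (α t)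
  state : ∀ t : ℝ, 0 ≤ t → ∀ x ∈ S, ⟪α t x Ω, Ω⟫_ℂ = ⟪x Ω, Ω⟫_ℂ
  id0 : ∀ x ∈ S, α 0 x = x
  semigroup : ∀ s t : ℝ, 0 ≤ s → 0 ≤ t → ∀ x ∈ S, α s (α t x) = α (s + t) x
  weakCont : ∀ x ∈ S, ∀ ξ η : H, ContinuousOn (fun t : ℝ => ⟪α t x ξ, η⟫_ℂ) (Set.Ici 0)

/-! ### Normal unital star endomorphisms of `B(H)` -/

/-- Normal unital star endomorphisms of `B(H)`. -/
structure NHom (Θ : (H →L[ℂ] H) → (H →L[ℂ] H)) : Prop where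
  hom : IsStarHomOn (Set.univ : Set (H →L[ℂ] H)) Θ
  unital : Θ 1 = 1
  normal : IsNormalMapOn (Set.univ : Set (H →L[ℂ] H)) Θ

/-- The star algebra homomorphism bundled from `NHom`. -/
def NHom.toHom {Θ : (H →L[ℂ] H) → (H →L[ℂ] H)} (h : NHom Θ) :
    (H →L[ℂ] H) →⋆ₙₐ[ℂ] (H →L[ℂ] H) where
  toFun := Θ
  map_smul' c x := h.hom.map_smul c x trivial
  map_zero' := by
    have := h.hom.map_smul 0 0 trivial
    simpa using this
  map_add' x y := h.hom.map_add x trivial y trivial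
  map_mul' x y := h.hom.map_mul x trivial y trivial
  map_star' x := h.hom.map_star x trivial

lemma NHom.norm_le {Θ : (H →L[ℂ] H) → (H →L[ℂ] H)} (h : NHom Θ) (x : H →L[ℂ] H) :
    ‖Θ x‖ ≤ ‖x‖ := NonUnitalStarAlgHom.norm_apply_le h.toHom x

lemma NHom.comp {Θ Θ' : (H →L[ℂ] H) → (H →L[ℂ] H)} (h : NHom Θ) (h' : NHom Θ') :
    NHom (fun x => Θ (Θ' x)) where
  hom :=
    { map_add := fun x _ y _ => by
        rw [h'.hom.map_add x trivial y trivial, h.hom.map_add _ trivial _ trivial]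
      map_smul := fun c x _ => by
        rw [h'.hom.map_smul c x trivial, h.hom.map_smul c _ trivial]
      map_mul := fun x _ y _ => by
        rw [h'.hom.map_mul x trivial y trivial, h.hom.map_mul _ trivial _ trivial]
      map_star := fun x _ => by
        rw [h'.hom.map_star x trivial, h.hom.map_star _ trivial] }
  unital := by rw [h'.unital, h.unital]
  normal := by
    intro ι p q hp hq hproj horth hsum
    refine h.normal (fun i => Θ' (p i)) (Θ' q) (fun _ => trivial) trivial ?_ ?_
      (h'.normal p q hp hq hproj horth hsum)
    · intro i
      refine ⟨?_, ?_⟩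
      · have := h'.hom.map_star (p i) trivial
        rw [(hproj i).1.star_eq] at this
        exact this.symm
      · rw [← h'.hom.map_mul _ trivial _ trivial, (hproj i).2]
    · intro i k hik
      rw [← h'.hom.map_mul _ trivial _ trivial, horth i k hik]
      exact map_zero h'.toHom

lemma NHom.id : NHom (fun x : H →L[ℂ] H => x) where
  hom := ⟨fun _ _ _ _ => rfl, fun _ _ _ => rfl, fun _ _ _ _ => rfl, fun _ _ => rfl⟩
  unital := rfl
  normal := by
    intro ι p q hp hq hproj horth hsum
    exact hsum

/-- The intertwiners `η ↦ Θ(|η⟩⟨a|) b`. -/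
def NHom.V {Θ : (H →L[ℂ] H) → (H →L[ℂ] H)} (h : NHom Θ) (a b : H) : H →L[ℂ] H :=
  LinearMap.mkContinuous
    { toFun := fun η => Θ (InnerProductSpace.rankOne ℂ η a) b
      map_add' := fun η η' => by
        rw [map_add, ContinuousLinearMap.add_apply, h.hom.map_add _ trivial _ trivial,
          ContinuousLinearMap.add_apply]
      map_smul' := fun c η => by
        rw [map_smul, ContinuousLinearMap.smul_apply, h.hom.map_smul _ _ trivial,
          ContinuousLinearMap.smul_apply, RingHom.id_apply] }
    (‖a‖ * ‖b‖)
    (fun η => by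
      refine ((Θ (InnerProductSpace.rankOne ℂ η a)).le_opNorm b).trans ?_
      have := h.norm_le (InnerProductSpace.rankOne ℂ η a)
      rw [InnerProductSpace.norm_rankOne] at this
      calc _ ≤ (‖η‖ * ‖a‖) * ‖b‖ := by gcongr
        _ = _ := by ring)

lemma NHom.V_apply {Θ : (H →L[ℂ] H) → (H →L[ℂ] H)} (h : NHom Θ) (a b η : H) :
    h.V a b η = Θ (InnerProductSpace.rankOne ℂ η a) b := rfl

lemma NHom.V_intertwines {Θ : (H →L[ℂ] H) → (H →L[ℂ] H)} (h : NHom Θ) (a b : H)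
    (x : H →L[ℂ] H) : Θ x * h.V a b = h.V a b * x := by
  ext η
  change Θ x (Θ (InnerProductSpace.rankOne ℂ η a) b) = Θ (InnerProductSpace.rankOne ℂ (x η) a) b
  rw [← ContinuousLinearMap.mul_apply, ← h.hom.map_mul _ trivial _ trivial]
  congr 2
  exact InnerProductSpace.comp_rankOne _ _ _

lemma NHom.eq_zero_of_mul_V {Θ : (H →L[ℂ] H) → (H →L[ℂ] H)} (h : NHom Θ)
    (T : H →L[ℂ] H) (hT : ∀ a b, T * h.V a b = 0) : T = 0 := by
  ext ζ
  obtain ⟨w, b, -⟩ := exists_hilbertBasis ℂ H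
  have key := h.normal (fun i : w => InnerProductSpace.rankOne ℂ (b i) (b i)) 1
    (fun _ => trivial) trivial ?_ ?_ ?_ ζ
  · rw [h.unital] at key
    have k2 := key.mapL T
    have h0 : ∀ i : w, T (Θ (InnerProductSpace.rankOne ℂ (b i) (b i)) ζ) = 0 := by
      intro i
      have := congrArg (fun S : H →L[ℂ] H => S (b i)) (hT (b i) ζ)
      exact this
    simp only [h0] at k2
    exact k2.unique hasSum_zero
  · intro i
    have := InnerProductSpace.isStarProjection_rankOne_self (𝕜 := ℂ) (b.orthonormal.1 i)
    exact ⟨this.isSelfAdjoint, this.isIdempotentElem⟩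
  · intro i k hik
    ext ξ
    have : ⟪b i, b k⟫_ℂ = 0 := b.orthonormal.2 hik
    simp [this]
  · intro ξ
    simpa [b.repr_apply_apply] using b.hasSum_repr ξ

lemma NHom.eq_zero_of_star_V_mul {Θ : (H →L[ℂ] H) → (H →L[ℂ] H)} (h : NHom Θ)
    (T : H →L[ℂ] H) (hT : ∀ a b, star (h.V a b) * T = 0) : T = 0 := by
  rw [← star_eq_zero]
  refine h.eq_zero_of_mul_V _ fun a b => ?_
  rw [← star_eq_zero, star_mul, star_star, hT]

lemma NHom.star_V {Θ : (H →L[ℂ] H) → (H →L[ℂ] H)} (h : NHom Θ) (a b : H)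
    (x : H →L[ℂ] H) : star (h.V a b) * Θ x = x * star (h.V a b) := by
  have := congrArg star (h.V_intertwines a b (star x))
  rw [star_mul, star_mul, h.hom.map_star x trivial, star_star, star_star] at this
  exact this

/-- An intertwiner on an irreducible set is an intertwiner on all of `B(H)`. -/
lemma NHom.intertwine {Θ : (H →L[ℂ] H) → (H →L[ℂ] H)} (h : NHom Θ)
    (S : Set (H →L[ℂ] H))
    (hS : ∀ T : H →L[ℂ] H, (∀ x ∈ S, T * x = x * T) → ∃ c : ℂ, T = c • (1 : H →L[ℂ] H))
    (W : H →L[ℂ] H) (hW : ∀ x ∈ S, Θ x * W = W * x) (x : H →L[ℂ] H) : Θ x * W = W * x := by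
  rw [← sub_eq_zero]
  refine h.eq_zero_of_star_V_mul _ fun a b => ?_
  obtain ⟨c, hc⟩ := hS (star (h.V a b) * W) (fun y hy => by
    rw [mul_assoc, ← hW y hy, ← mul_assoc, h.star_V, mul_assoc])
  rw [mul_sub, ← mul_assoc, h.star_V, mul_assoc, ← mul_assoc _ W x, hc]
  simp

lemma NHom.ext {Θ Θ' : (H →L[ℂ] H) → (H →L[ℂ] H)} (h : NHom Θ) (h' : NHom Θ')
    (S : Set (H →L[ℂ] H))
    (hS : ∀ T : H →L[ℂ] H, (∀ x ∈ S, T * x = x * T) → ∃ c : ℂ, T = c • (1 : H →L[ℂ] H))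
    (hag : ∀ x ∈ S, Θ x = Θ' x) : Θ = Θ' := by
  funext x
  rw [← sub_eq_zero]
  refine h'.eq_zero_of_mul_V _ fun a b => ?_
  rw [sub_mul, h'.V_intertwines,
    h.intertwine S hS (h'.V a b) (fun y hy => by rw [hag y hy, h'.V_intertwines]), sub_self]

/-! ### The conjugation `j` -/

section Conjugation

variable {M : VonNeumannAlgebra H} {Ω : H} {J : H → H} {j : (H →L[ℂ] H) → (H →L[ℂ] H)}

lemma StandardForm.normJ (h : StandardForm M Ω J j) (ξ : H) : ‖J ξ‖ = ‖ξ‖ := by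
  have := h.Jinner ξ ξ
  rw [inner_self_eq_norm_sq_to_K, inner_self_eq_norm_sq_to_K] at this
  have h2 : ‖J ξ‖ ^ 2 = ‖ξ‖ ^ 2 := by exact_mod_cast this
  exact (pow_left_inj₀ (norm_nonneg _) (norm_nonneg _) two_ne_zero).1 h2

/-- `J` as an additive map. -/
def StandardForm.Jhom (h : StandardForm M Ω J j) : H →+ H := AddMonoidHom.mk' J h.Jadd

lemma StandardForm.contJ (h : StandardForm M Ω J j) : Continuous J :=
  (AddMonoidHomClass.isometry_of_norm h.Jhom h.normJ).continuous

lemma StandardForm.hasSumJ (h : StandardForm M Ω J j) {ι : Type} {f : ι → H} {a : H}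
    (hf : HasSum f a) : HasSum (fun i => J (f i)) (J a) :=
  hf.map h.Jhom h.contJ

lemma StandardForm.jj (h : StandardForm M Ω J j) (x : H →L[ℂ] H) : j (j x) = x := by
  ext ξ
  rw [h.jdef, h.jdef, h.Jinvol, h.Jinvol]

lemma StandardForm.j_add (h : StandardForm M Ω J j) (x y : H →L[ℂ] H) :
    j (x + y) = j x + j y := by
  ext ξ
  rw [ContinuousLinearMap.add_apply, h.jdef, h.jdef, h.jdef, ContinuousLinearMap.add_apply, h.Jadd]

lemma StandardForm.j_smul (h : StandardForm M Ω J j) (c : ℂ) (x : H →L[ℂ] H) :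
    j (c • x) = (starRingEnd ℂ) c • j x := by
  ext ξ
  rw [ContinuousLinearMap.smul_apply, h.jdef, h.jdef, ContinuousLinearMap.smul_apply, h.Jsmul]

lemma StandardForm.j_mul (h : StandardForm M Ω J j) (x y : H →L[ℂ] H) :
    j (x * y) = j x * j y := by
  ext ξ
  rw [ContinuousLinearMap.mul_apply, h.jdef, h.jdef, h.jdef, ContinuousLinearMap.mul_apply,
    h.Jinvol]

lemma StandardForm.j_one (h : StandardForm M Ω J j) : j 1 = 1 := by
  ext ξ
  rw [h.jdef, ContinuousLinearMap.one_apply, ContinuousLinearMap.one_apply, h.Jinvol]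

lemma StandardForm.j_zero (h : StandardForm M Ω J j) : j 0 = 0 := by
  have := h.j_smul 0 0
  simpa using this

lemma StandardForm.inner_J (h : StandardForm M Ω J j) (ξ η : H) :
    ⟪J ξ, η⟫_ℂ = ⟪J η, ξ⟫_ℂ := by
  rw [← h.Jinner, h.Jinvol]

lemma StandardForm.j_star (h : StandardForm M Ω J j) (x : H →L[ℂ] H) :
    j (star x) = star (j x) := by
  ext ξ
  refine ext_inner_right ℂ fun η => ?_
  rw [ContinuousLinearMap.star_eq_adjoint, ContinuousLinearMap.star_eq_adjoint,
    ContinuousLinearMap.adjoint_inner_left, h.jdef, h.jdef, h.inner_J,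
    ContinuousLinearMap.adjoint_inner_right, ← h.Jinner, h.Jinvol]

lemma StandardForm.j_mem (h : StandardForm M Ω J j) {y : H →L[ℂ] H}
    (hy : y ∈ Set.centralizer (M : Set (H →L[ℂ] H))) : j y ∈ (M : Set (H →L[ℂ] H)) := by
  obtain ⟨x, hx, rfl⟩ := h.jsurj y hy
  rw [h.jj]
  exact hx

lemma StandardForm.irred (h : StandardForm M Ω J j) (hM : IsFactorSet (M : Set (H →L[ℂ] H)))
    (T : H →L[ℂ] H)
    (hT : ∀ x ∈ (M : Set (H →L[ℂ] H)) ∪ Set.centralizer (M : Set (H →L[ℂ] H)),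
      T * x = x * T) : ∃ c : ℂ, T = c • (1 : H →L[ℂ] H) := by
  refine hM T ?_ (fun y hy => hT y (Or.inl hy))
  rw [← M.centralizer_centralizer]
  intro y hy
  exact (hT y (Or.inr hy)).symm

end Conjugation

/-- Part (1). -/
lemma part_one
    (M : VonNeumannAlgebra H) (Ω : H) (J : H → H) (j : (H →L[ℂ] H) → (H →L[ℂ] H))
    (hSF : StandardForm M Ω J j)
    (α : ℝ → (H →L[ℂ] H) → (H →L[ℂ] H))
    (hα : IsE0SemigroupSet (M : Set (H →L[ℂ] H)) Ω α) :
    IsE0SemigroupSet (Set.centralizer (M : Set (H →L[ℂ] H))) Ω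
      (fun t y => j (α t (j y))) where
  mapsTo t ht y hy := hSF.jmapsTo _ (hα.mapsTo t ht (hSF.j_mem hy))
  unital t ht := by
    change j (α t (j 1)) = 1
    rw [hSF.j_one, hα.unital t ht, hSF.j_one]
  hom t ht :=
    { map_add := fun x hx y hy => by
        rw [hSF.j_add, (hα.hom t ht).map_add _ (hSF.j_mem hx) _ (hSF.j_mem hy), hSF.j_add]
      map_smul := fun c x hx => by
        rw [hSF.j_smul, (hα.hom t ht).map_smul _ _ (hSF.j_mem hx), hSF.j_smul, Complex.conj_conj]
      map_mul := fun x hx y hy => by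
        rw [hSF.j_mul, (hα.hom t ht).map_mul _ (hSF.j_mem hx) _ (hSF.j_mem hy), hSF.j_mul]
      map_star := fun x hx => by
        rw [hSF.j_star, (hα.hom t ht).map_star _ (hSF.j_mem hx), hSF.j_star] }
  normal t ht := by
    intro ι p q hp hq hproj horth hsum ξ
    simp only [hSF.jdef]
    apply hSF.hasSumJ
    refine hα.normal t ht (fun i => j (p i)) (j q) (fun i => hSF.j_mem (hp i)) (hSF.j_mem hq)
      ?_ ?_ ?_ (J ξ)
    · intro i
      refine ⟨?_, ?_⟩
      · have := hSF.j_star (p i)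
        rw [(hproj i).1.star_eq] at this
        exact this.symm
      · rw [← hSF.j_mul, (hproj i).2]
    · intro i k hik
      rw [← hSF.j_mul, horth i k hik, hSF.j_zero]
    · intro ζ
      simp only [hSF.jdef]
      exact hSF.hasSumJ (hsum (J ζ))
  state t ht y hy := by
    change ⟪j (α t (j y)) Ω, Ω⟫_ℂ = _
    have h1 : ∀ z : H →L[ℂ] H, ⟪j z Ω, Ω⟫_ℂ = (starRingEnd ℂ) ⟪z Ω, Ω⟫_ℂ := fun z => by
      rw [hSF.jdef, hSF.inner_J, hSF.JΩ, inner_conj_symm]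
    rw [h1, hα.state t ht _ (hSF.j_mem hy), ← h1, hSF.jj]
  id0 y hy := by
    change j (α 0 (j y)) = y
    rw [hα.id0 _ (hSF.j_mem hy), hSF.jj]
  semigroup s t hs ht y hy := by
    change j (α s (j (j (α t (j y))))) = j (α (s + t) (j y))
    rw [hSF.jj, hα.semigroup s t hs ht _ (hSF.j_mem hy)]
  weakCont y hy ξ η := by
    have h1 : (fun t : ℝ => ⟪j (α t (j y)) ξ, η⟫_ℂ) =
        fun t : ℝ => (starRingEnd ℂ) ⟪α t (j y) (J ξ), J η⟫_ℂ := by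
      funext t
      rw [hSF.jdef, hSF.inner_J, inner_conj_symm]
    rw [h1]
    exact Complex.continuous_conj.comp_continuousOn (hα.weakCont _ (hSF.j_mem hy) _ _)

/-- Strong continuity at zero of the implementing isometries. -/
lemma strong_cont_zero
    (M : VonNeumannAlgebra H) (Ω : H) (J : H → H) (j : (H →L[ℂ] H) → (H →L[ℂ] H))
    (hSF : StandardForm M Ω J j)
    (α : ℝ → (H →L[ℂ] H) → (H →L[ℂ] H))
    (hα : IsE0SemigroupSet (M : Set (H →L[ℂ] H)) Ω α)
    (u : ℝ → (H →L[ℂ] H)) (hu : ∀ t, 0 ≤ t → Implements M Ω (α t) (u t)) (ξ : H)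
    (ε : ℝ) (hε : 0 < ε) : ∃ δ > 0, ∀ t, 0 ≤ t → t < δ → ‖u t ξ - ξ‖ < ε := by
  obtain ⟨ζ, hζ, ⟨x, hx, rfl⟩⟩ := Metric.dense_iff.1 hSF.cyclic ξ (ε / 3) (by positivity)
  rw [Metric.mem_ball, dist_eq_norm] at hζ
  have hc := hα.weakCont x hx Ω (x Ω) 0 (Set.mem_Ici.2 le_rfl)
  rw [Metric.continuousWithinAt_iff] at hc
  obtain ⟨δ, hδ, h⟩ := hc ((ε / 3) ^ 2 / 2) (by positivity)
  refine ⟨δ, hδ, fun t ht htd => ?_⟩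
  have h1 := h (Set.mem_Ici.2 ht) (by rw [Real.dist_eq, sub_zero, abs_of_nonneg ht]; exact htd)
  rw [hα.id0 x hx, ← (hu t ht).2 x hx, dist_eq_norm] at h1
  have h2 : ‖u t (x Ω) - x Ω‖ ^ 2 < (ε / 3) ^ 2 := by
    rw [@norm_sub_sq ℂ, (hu t ht).1]
    have h3 := (Complex.abs_re_le_norm _).trans_lt h1
    have h4 : (⟪x Ω, x Ω⟫_ℂ).re = ‖x Ω‖ ^ 2 := by
      rw [inner_self_eq_norm_sq_to_K]
      norm_cast
    rw [Complex.sub_re, h4, abs_lt] at h3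
    change ‖x Ω‖ ^ 2 - 2 * (⟪u t (x Ω), x Ω⟫_ℂ).re + ‖x Ω‖ ^ 2 < _
    linarith [h3.1]
  have h3 : ‖u t (x Ω) - x Ω‖ < ε / 3 := lt_of_pow_lt_pow_left₀ 2 (by positivity) h2
  have h4 : ‖u t (ξ - x Ω)‖ < ε / 3 := by
    rw [(hu t ht).1, norm_sub_rev]; exact hζ
  calc ‖u t ξ - ξ‖ = ‖u t (ξ - x Ω) + (u t (x Ω) - x Ω) + (x Ω - ξ)‖ := by
        rw [map_sub]; congr 1; abel
    _ ≤ ‖u t (ξ - x Ω)‖ + ‖u t (x Ω) - x Ω‖ + ‖x Ω - ξ‖ := norm_add₃_le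
    _ < ε := by linarith

lemma NHom.inner_bound {Θ : (H →L[ℂ] H) → (H →L[ℂ] H)} (h : NHom Θ) (u : H →L[ℂ] H)
    (hn : ∀ ξ, ‖u ξ‖ = ‖ξ‖) (hu : ∀ x, Θ x * u = u * x) (y : H →L[ℂ] H) (ξ η : H) :
    ‖⟪Θ y ξ, η⟫_ℂ - ⟪y ξ, η⟫_ℂ‖ ≤ ‖y‖ * (‖u ξ - ξ‖ * ‖η‖ + ‖ξ‖ * ‖u η - η‖) := by
  have hin : ∀ a b, ⟪u a, u b⟫_ℂ = ⟪a, b⟫_ℂ := by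
    have := (LinearMap.norm_map_iff_inner_map_map u).1 hn
    exact this
  have e : ⟪Θ y ξ, η⟫_ℂ - ⟪y ξ, η⟫_ℂ = -⟪Θ y (u ξ - ξ), η⟫_ℂ - ⟪Θ y (u ξ), u η - η⟫_ℂ := by
    have h1 : ⟪y ξ, η⟫_ℂ = ⟪Θ y (u ξ), u η⟫_ℂ := by
      rw [← ContinuousLinearMap.mul_apply, hu, ContinuousLinearMap.mul_apply, hin]
    rw [h1, map_sub, inner_sub_left, inner_sub_right]
    ring
  rw [e]
  have b1 : ‖⟪Θ y (u ξ - ξ), η⟫_ℂ‖ ≤ ‖y‖ * ‖u ξ - ξ‖ * ‖η‖ := by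
    refine (norm_inner_le_norm _ _).trans ?_
    gcongr
    exact ((Θ y).le_opNorm _).trans (by gcongr; exact h.norm_le y)
  have b2 : ‖⟪Θ y (u ξ), u η - η⟫_ℂ‖ ≤ ‖y‖ * ‖ξ‖ * ‖u η - η‖ := by
    refine (norm_inner_le_norm _ _).trans ?_
    gcongr
    refine ((Θ y).le_opNorm _).trans ?_
    rw [hn]
    gcongr
    exact h.norm_le y
  refine (norm_sub_le _ _).trans ?_
  rw [norm_neg]
  linarith

/-- **Proposition 5.3.**  Let `α = {α_t : t ≥ 0}` be an `E₀`-semigroup on the factorial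
probability space `(M, φ)` in standard form.  Then (1) `α′_t = j ∘ α_t ∘ j` defines an
`E₀`-semigroup on `(M′, φ′)`; and (2) if each `α_t` is equi-modular and extendable, there is a
unique `E₀`-semigroup `α⁽²⁾` on `(B(L²(M,φ)), ω_Ω)` with
`α⁽²⁾_t(x x′) = α_t(x) α′_t(x′)` for all `x ∈ M`, `x′ ∈ M′`. -/
theorem proposition_5_3
    (M : VonNeumannAlgebra H) (Ω : H) (J : H → H) (j : (H →L[ℂ] H) → (H →L[ℂ] H))
    (hSF : StandardForm M Ω J j) (hM : IsFactorSet (M : Set (H →L[ℂ] H)))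
    (α : ℝ → (H →L[ℂ] H) → (H →L[ℂ] H))
    (hα : IsE0SemigroupSet (M : Set (H →L[ℂ] H)) Ω α) :
    -- (1) `α′` is an `E₀`-semigroup on `(M′, φ′)`:
    IsE0SemigroupSet (Set.centralizer (M : Set (H →L[ℂ] H))) Ω
      (fun t y => j (α t (j y))) ∧
    -- (2) if each `α_t` is equi-modular and extendable ...
    ((∀ t : ℝ, 0 ≤ t → EquiModular M Ω J (α t) ∧ Extendable M j (α t)) →
      -- ... there is a unique `E₀`-semigroup `α⁽²⁾` on `B(L²(M,φ))` with
      -- `α⁽²⁾_t (x x′) = α_t(x) α′_t(x′)`: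
      ∃ β : ℝ → (H →L[ℂ] H) → (H →L[ℂ] H),
        (IsE0SemigroupSet (Set.univ : Set (H →L[ℂ] H)) Ω β ∧
          ∀ t : ℝ, 0 ≤ t → ∀ x ∈ M, ∀ y ∈ Set.centralizer (M : Set (H →L[ℂ] H)),
            β t (x * y) = α t x * j (α t (j y))) ∧
        ∀ β' : ℝ → (H →L[ℂ] H) → (H →L[ℂ] H),
          (IsE0SemigroupSet (Set.univ : Set (H →L[ℂ] H)) Ω β' ∧
            ∀ t : ℝ, 0 ≤ t → ∀ x ∈ M, ∀ y ∈ Set.centralizer (M : Set (H →L[ℂ] H)),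
              β' t (x * y) = α t x * j (α t (j y))) →
          ∀ t : ℝ, 0 ≤ t → β' t = β t) := by
  refine ⟨part_one M Ω J j hSF α hα, fun hEE => ?_⟩
  classical
  have hirr := hSF.irred hM
  have hchoice : ∀ t : ℝ, ∃ Θ : (H →L[ℂ] H) → (H →L[ℂ] H), 0 ≤ t → IsExtension M j (α t) Θ := by
    intro t
    by_cases ht : 0 ≤ t
    · obtain ⟨Θ, hΘ⟩ := (hEE t ht).2
      exact ⟨Θ, fun _ => hΘ⟩
    · exact ⟨fun x => x, fun h => absurd h ht⟩
  choose β hβ using hchoice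
  have hchoiceu : ∀ t : ℝ, ∃ u : H →L[ℂ] H,
      0 ≤ t → Implements M Ω (α t) u ∧ CommutesWithJ J u := by
    intro t
    by_cases ht : 0 ≤ t
    · obtain ⟨u, hu⟩ := (hEE t ht).1
      exact ⟨u, fun _ => hu⟩
    · exact ⟨0, fun h => absurd h ht⟩
  choose u hu using hchoiceu
  have hN : ∀ t, 0 ≤ t → NHom (β t) := fun t ht => ⟨(hβ t ht).hom, (hβ t ht).unital, (hβ t ht).normal⟩
  have hβ' : ∀ t, 0 ≤ t → ∀ y ∈ Set.centralizer (M : Set (H →L[ℂ] H)),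
      β t y = j (α t (j y)) := by
    intro t ht y hy
    have := (hβ t ht).onComm (j y) (hSF.j_mem hy)
    rwa [hSF.jj] at this
  -- the implementing isometries intertwine on `M`
  have huM : ∀ t, 0 ≤ t → ∀ x ∈ M, α t x * u t = u t * x := by
    intro t ht x hx
    have himp := (hu t ht).1.2
    ext ξ
    have hcl : IsClosed {ξ : H | (α t x * u t) ξ = (u t * x) ξ} :=
      isClosed_eq (α t x * u t).continuous (u t * x).continuous
    have hsub : {ξ : H | ∃ x ∈ M, x Ω = ξ} ⊆ {ξ : H | (α t x * u t) ξ = (u t * x) ξ} := by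
      rintro _ ⟨y, hy, rfl⟩
      change α t x (u t (y Ω)) = u t (x (y Ω))
      rw [himp y hy, ← ContinuousLinearMap.mul_apply, ← (hα.hom t ht).map_mul x hx y hy,
        ← himp _ (mul_mem hx hy)]
      rfl
    exact hcl.closure_subset_iff.2 hsub (hSF.cyclic ξ)
  have huA : ∀ t, 0 ≤ t → ∀ x, β t x * u t = u t * x := by
    intro t ht
    refine (hN t ht).intertwine _ hirr (u t) ?_
    rintro x (hx | hx)
    · rw [(hβ t ht).onM x hx, huM t ht x hx]
    · rw [hβ' t ht x hx]
      ext ξ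
      have hJ := (hu t ht).2
      rw [ContinuousLinearMap.mul_apply, hSF.jdef, ← hJ, ← ContinuousLinearMap.mul_apply,
        huM t ht _ (hSF.j_mem hx), ContinuousLinearMap.mul_apply, ← hJ, ← hSF.jdef, hSF.jj]
      rfl
  have huΩ : ∀ t, 0 ≤ t → u t Ω = Ω := by
    intro t ht
    have := (hu t ht).1.2 1 (one_mem M)
    rw [hα.unital t ht] at this
    exact this
  have hsemi : ∀ s t : ℝ, 0 ≤ s → 0 ≤ t → ∀ x, β s (β t x) = β (s + t) x := by
    intro s t hs ht x
    have hst := add_nonneg hs ht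
    refine congrFun (((hN s hs).comp (hN t ht)).ext (hN _ hst) _ hirr ?_) x
    rintro x (hx | hx)
    · rw [(hβ t ht).onM x hx, (hβ s hs).onM _ (hα.mapsTo t ht hx), (hβ _ hst).onM x hx,
        hα.semigroup s t hs ht x hx]
    · rw [hβ' t ht x hx, (hβ s hs).onComm _ (hα.mapsTo t ht (hSF.j_mem hx)), hβ' _ hst x hx,
        hα.semigroup s t hs ht _ (hSF.j_mem hx)]
  refine ⟨β, ⟨?_, ?_⟩, ?_⟩
  · refine ⟨fun t ht x _ => trivial, fun t ht => (hβ t ht).unital, fun t ht => (hβ t ht).hom,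
      fun t ht => (hβ t ht).normal, ?_, ?_, fun s t hs ht x _ => hsemi s t hs ht x, ?_⟩
    · intro t ht x _
      have hin := (LinearMap.norm_map_iff_inner_map_map (u t)).1 (hu t ht).1.1
      have h1 : β t x Ω = u t (x Ω) := by
        have := congrArg (fun S : H →L[ℂ] H => S Ω) (huA t ht x)
        simpa [huΩ t ht] using this
      calc ⟪β t x Ω, Ω⟫_ℂ = ⟪u t (x Ω), u t Ω⟫_ℂ := by rw [h1, huΩ t ht]
        _ = _ := hin _ _
    · intro x _
      refine congrFun ((hN 0 le_rfl).ext NHom.id _ hirr ?_) x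
      rintro x (hx | hx)
      · rw [(hβ 0 le_rfl).onM x hx, hα.id0 x hx]
      · rw [hβ' 0 le_rfl x hx, hα.id0 _ (hSF.j_mem hx), hSF.jj]
    · intro x _ ξ η
      have hbound : ∀ s t : ℝ, 0 ≤ s → s ≤ t → ‖⟪β t x ξ, η⟫_ℂ - ⟪β s x ξ, η⟫_ℂ‖ ≤
          ‖x‖ * (‖u (t - s) ξ - ξ‖ * ‖η‖ + ‖ξ‖ * ‖u (t - s) η - η‖) := by
        intro s t hs hst
        have hts := sub_nonneg.2 hst
        have h1 := (hN _ hts).inner_bound (u (t - s)) (hu _ hts).1.1 (huA _ hts) (β s x) ξ η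
        rw [hsemi _ _ hts hs, sub_add_cancel] at h1
        refine h1.trans ?_
        gcongr
        exact (hN s hs).norm_le x
      intro t ht
      rw [Metric.continuousWithinAt_iff]
      intro ε hε
      set C := ‖x‖ * (‖η‖ + ‖ξ‖) + 1 with hC
      have hCpos : 0 < C := by positivity
      obtain ⟨δ₁, hδ₁, h1⟩ := strong_cont_zero M Ω J j hSF α hα u (fun t ht => (hu t ht).1) ξ
        (ε / C) (by positivity)
      obtain ⟨δ₂, hδ₂, h2⟩ := strong_cont_zero M Ω J j hSF α hα u (fun t ht => (hu t ht).1) η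
        (ε / C) (by positivity)
      have hfin : ∀ r : ℝ, 0 ≤ r → r < min δ₁ δ₂ →
          ‖x‖ * (‖u r ξ - ξ‖ * ‖η‖ + ‖ξ‖ * ‖u r η - η‖) < ε := by
        intro r hr hrd
        have a1 := (h1 r hr (hrd.trans_le (min_le_left _ _))).le
        have a2 := (h2 r hr (hrd.trans_le (min_le_right _ _))).le
        calc _ ≤ ‖x‖ * (ε / C * ‖η‖ + ‖ξ‖ * (ε / C)) := by gcongr
          _ = (ε / C) * (C - 1) := by rw [hC]; ring
          _ < (ε / C) * C := by
            apply mul_lt_mul_of_pos_left _ (by positivity)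
            linarith
          _ = ε := by field_simp
      refine ⟨min δ₁ δ₂, lt_min hδ₁ hδ₂, fun s hs hst => ?_⟩
      rw [Real.dist_eq] at hst
      rcases le_total s t with hle | hle
      · rw [dist_comm, dist_eq_norm]
        refine (hbound s t hs hle).trans_lt (hfin _ (sub_nonneg.2 hle) ?_)
        rwa [abs_sub_comm, abs_of_nonneg (sub_nonneg.2 hle)] at hst
      · rw [dist_eq_norm]
        refine (hbound t s ht hle).trans_lt (hfin _ (sub_nonneg.2 hle) ?_)
        rwa [abs_of_nonneg (sub_nonneg.2 hle)] at hst
  · intro t ht x hx y hy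
    rw [(hβ t ht).hom.map_mul x trivial y trivial, (hβ t ht).onM x hx, hβ' t ht y hy]
  · rintro γ ⟨hγ, hγm⟩ t ht
    have hNγ : NHom (γ t) := ⟨hγ.hom t ht, hγ.unital t ht, hγ.normal t ht⟩
    refine hNγ.ext (hN t ht) _ hirr ?_
    rintro x (hx | hx)
    · have := hγm t ht x hx 1 Set.one_mem_centralizer
      rw [mul_one, hSF.j_one, hα.unital t ht, hSF.j_one, mul_one] at this
      rw [this, (hβ t ht).onM x hx]
    · have := hγm t ht 1 (one_mem M) x hx
      rw [one_mul, hα.unital t ht, one_mul] at this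
      rw [this, hβ' t ht x hx]

end Paper
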